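/- arXiv:2503.01153 — 3 statements merged into one kernel-verified Lean document; each statement's English description precedes it below -/
import Mathlib

section
/- Let G be the setwise stabilizer of {α0+α1, α2+α3} in Ŵ, and let G_β = ⟨w0∘w3∘w0, w1∘w2∘w1, (σ1∘σ2)²⟩ and G_γ = ⟨σ2∘w2∘w0, σ1∘σ2∘σ1∘w3∘w1, σ1⟩ be subgroups of Ŵ. Then every element of G_β commutes with every element of G_γ, G_β ∩ G_γ = {1}, G = G_β · G_γ, and each of G_β and G_γ is isomorphic to the free product ℤ/2 * ℤ/2 (the infinite dihedral group, i.e. the extended affine Weyl group of type A1^(1)). In particular G is isomorphic to the direct product of two infinite dihedral groups. -/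
open Pointwise

/-- The Picard lattice `Pic`, with basis `H1, H2, E1, …, E8`
(coordinates `0 ↦ H1`, `1 ↦ H2`, `i+1 ↦ Eᵢ`). -/
abbrev Pic : Type := Fin 10 → ℤ

/-- The intersection form `•` : `H1•H2 = 1`, `Eᵢ•Eᵢ = -1`, all other pairings
of basis vectors being `0`. -/
def inter (x y : Pic) : ℤ :=
  x 0 * y 1 + x 1 * y 0 -
    (x 2 * y 2 + x 3 * y 3 + x 4 * y 4 + x 5 * y 5 + x 6 * y 6 +
      x 7 * y 7 + x 8 * y 8 + x 9 * y 9)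

/-- The `j`-th basis vector of `Pic`. -/
def bvec (j : Fin 10) : Pic := fun k => if k = j then 1 else 0

/-- The matrix of the reflection `C ↦ C + (C • a)·a` in `a`. -/
def reflMat (a : Pic) : Matrix (Fin 10) (Fin 10) ℤ :=
  Matrix.of fun k j => (if k = j then 1 else 0) + inter (bvec j) a * a k

/-- The matrix of the linear map sending the basis vector `e j` to `e (p j)`. -/
def permMat (p : Fin 10 → Fin 10) : Matrix (Fin 10) (Fin 10) ℤ :=
  Matrix.of fun k j => if p j = k then 1 else 0

/-- `α₀ = H2 - E1 - E2`. -/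
def al0 : Pic := ![0, 1, -1, -1, 0, 0, 0, 0, 0, 0]
/-- `α₁ = H1 - E5 - E6`. -/
def al1 : Pic := ![1, 0, 0, 0, 0, 0, -1, -1, 0, 0]
/-- `α₂ = H2 - E3 - E4`. -/
def al2 : Pic := ![0, 1, 0, 0, -1, -1, 0, 0, 0, 0]
/-- `α₃ = H1 - E7 - E8`. -/
def al3 : Pic := ![1, 0, 0, 0, 0, 0, 0, 0, -1, -1]
/-- `δ = 2H1 + 2H2 - E1 - ⋯ - E8`. -/
def dl : Pic := ![2, 2, -1, -1, -1, -1, -1, -1, -1, -1]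
/-- `μ = H1 - H2`. -/
def mu : Pic := ![1, -1, 0, 0, 0, 0, 0, 0, 0, 0]

/-- Automorphisms of the lattice `Pic`, realized as invertible integer `10 × 10`
matrices (acting on coordinate vectors by matrix-vector multiplication). -/
abbrev PicAut : Type := (Matrix (Fin 10) (Fin 10) ℤ)ˣ

/-- Build an automorphism of `Pic` out of an involutive matrix. -/
def mkAut (M : Matrix (Fin 10) (Fin 10) ℤ) (h : M * M = 1) : PicAut := ⟨M, M, h, h⟩

/-- `w₀`, the reflection `C ↦ C + (C•α₀)α₀`. -/
def w0 : PicAut := mkAut (reflMat al0) (by decide)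
/-- `w₁`, the reflection `C ↦ C + (C•α₁)α₁`. -/
def w1 : PicAut := mkAut (reflMat al1) (by decide)
/-- `w₂`, the reflection `C ↦ C + (C•α₂)α₂`. -/
def w2 : PicAut := mkAut (reflMat al2) (by decide)
/-- `w₃`, the reflection `C ↦ C + (C•α₃)α₃`. -/
def w3 : PicAut := mkAut (reflMat al3) (by decide)
/-- `σ₁`: the basis permutation `E1↔E7, E2↔E8, E3↔E5, E4↔E6` (fixing `H1`, `H2`)
composed with the reflection `w_μ` in `μ = H1 - H2`. -/
def sg1 : PicAut := mkAut (permMat ![0, 1, 8, 9, 6, 7, 4, 5, 2, 3] * reflMat mu) (by decide)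
/-- `σ₂`: the basis permutation `E1↔E3, E2↔E4` (fixing the other basis vectors). -/
def sg2 : PicAut := mkAut (permMat ![0, 1, 4, 5, 2, 3, 6, 7, 8, 9]) (by decide)
/-- `σ₃`: the basis permutation `E5↔E7, E6↔E8` (fixing the other basis vectors). -/
def sg3 : PicAut := mkAut (permMat ![0, 1, 2, 3, 4, 5, 8, 9, 6, 7]) (by decide)

/-- The action of an automorphism on `Pic`. -/
def act (g : PicAut) (v : Pic) : Pic := g.val.mulVec v

instance : MulAction PicAut Pic where
  smul := act
  one_smul v := by
    show act 1 v = v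
    simp [act]
  mul_smul g h v := by
    show act (g * h) v = act g (act h v)
    simp [act, Matrix.mulVec_mulVec]

lemma smul_eq_act (g : PicAut) (v : Pic) : g • v = act g v := rfl

/-- The fully extended affine Weyl group `Ŵ` of type `A₃⁽¹⁾`, i.e. the subgroup
of automorphisms of `Pic` generated by `w₀, w₁, w₂, w₃, σ₁, σ₂`. -/
def Wh : Subgroup PicAut := Subgroup.closure {w0, w1, w2, w3, sg1, sg2}

/-- The two-element set `{α₀+α₁, α₂+α₃} ⊆ Pic`. -/
def Spair : Set Pic := {al0 + al1, al2 + al3}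

/-- The setwise stabilizer `G` of `{α₀+α₁, α₂+α₃}` in `Ŵ`. -/
def G : Subgroup PicAut := Wh ⊓ MulAction.stabilizer PicAut Spair

/-- `G_β = ⟨w₀w₃w₀, w₁w₂w₁, (σ₁σ₂)²⟩`. -/
def Gb : Subgroup PicAut := Subgroup.closure {w0 * w3 * w0, w1 * w2 * w1, (sg1 * sg2) ^ 2}

/-- `G_γ = ⟨σ₂w₂w₀, σ₁σ₂σ₁w₃w₁, σ₁⟩`. -/
def Gg : Subgroup PicAut := Subgroup.closure {sg2 * w2 * w0, sg1 * sg2 * sg1 * w3 * w1, sg1}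

section Involutions

variable {M : Type*} [Group M] {x y : M}

lemma mul_zpow_mul_of_involutions (hx : x * x = 1) (hy : y * y = 1) (k : ℤ) :
    x * (x * y) ^ k = (x * y) ^ (-k) * x := by
  have h : SemiconjBy x (x * y) (x * y)⁻¹ := by
    have hx' : x⁻¹ = x := inv_eq_of_mul_eq_one_left hx
    have hy' : y⁻¹ = y := inv_eq_of_mul_eq_one_left hy
    simp only [SemiconjBy, mul_inv_rev, hx', hy', mul_assoc, hx, mul_one]
    rw [← mul_assoc, hx, one_mul]
  simpa only [SemiconjBy, inv_zpow'] using h.zpow_right k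

lemma exists_zpow_of_mem_closure_involutions (hx : x * x = 1) (hy : y * y = 1) {g : M}
    (hg : g ∈ Subgroup.closure {x, y}) :
    ∃ k : ℤ, g = (x * y) ^ k ∨ g = (x * y) ^ k * x := by
  have hx' : x⁻¹ = x := inv_eq_of_mul_eq_one_left hx
  have hy' : y⁻¹ = y := inv_eq_of_mul_eq_one_left hy
  have stepx : ∀ g, (∃ k : ℤ, g = (x * y) ^ k ∨ g = (x * y) ^ k * x) →
      ∃ k : ℤ, x * g = (x * y) ^ k ∨ x * g = (x * y) ^ k * x := by
    rintro g ⟨k, rfl | rfl⟩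
    · exact ⟨-k, Or.inr (mul_zpow_mul_of_involutions hx hy k)⟩
    · refine ⟨-k, Or.inl ?_⟩
      rw [← mul_assoc, mul_zpow_mul_of_involutions hx hy k, mul_assoc, hx, mul_one]
  have stepxy : ∀ g, (∃ k : ℤ, g = (x * y) ^ k ∨ g = (x * y) ^ k * x) →
      ∃ k : ℤ, (x * y) * g = (x * y) ^ k ∨ (x * y) * g = (x * y) ^ k * x := by
    rintro g ⟨k, rfl | rfl⟩
    · exact ⟨1 + k, Or.inl (by rw [zpow_add, zpow_one])⟩
    · exact ⟨1 + k, Or.inr (by rw [zpow_add, zpow_one, mul_assoc (x * y)])⟩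
  have stepy : ∀ g, (∃ k : ℤ, g = (x * y) ^ k ∨ g = (x * y) ^ k * x) →
      ∃ k : ℤ, y * g = (x * y) ^ k ∨ y * g = (x * y) ^ k * x := by
    intro g hg
    have := stepx _ (stepxy g hg)
    rwa [← mul_assoc, ← mul_assoc, hx, one_mul] at this
  induction hg using Subgroup.closure_induction_left with
  | one => exact ⟨0, Or.inl (by simp)⟩
  | mul_left z hz g _ ih =>
    rcases hz with rfl | rfl
    · exact stepx g ih
    · exact stepy g ih
  | inv_mul_cancel z hz g _ ih =>
    rcases hz with rfl | rfl
    · rw [hx']; exact stepx g ih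
    · rw [hy']; exact stepy g ih

/-- The homomorphism from the cyclic group of order two determined by an involution. -/
def involutionHom (x : M) (hx : x * x = 1) : Multiplicative (ZMod 2) →* M where
  toFun z := x ^ (Multiplicative.toAdd z).val
  map_one' := by simp
  map_mul' a b := by
    rw [toAdd_mul, ZMod.val_add, ← pow_add]
    exact (pow_eq_pow_mod _ (by rw [pow_two, hx])).symm

lemma involutionHom_ofAdd_one (hx : x * x = 1) :
    involutionHom x hx (Multiplicative.ofAdd 1) = x := by
  have h : (1 : ZMod 2).val = 1 := rfl
  simp [involutionHom, h]

lemma eq_one_or_eq_ofAdd_one (z : Multiplicative (ZMod 2)) :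
    z = 1 ∨ z = Multiplicative.ofAdd 1 := by
  revert z; decide

lemma closure_inl_inr_ofAdd_one :
    Subgroup.closure {Monoid.Coprod.inl (Multiplicative.ofAdd 1),
      Monoid.Coprod.inr (Multiplicative.ofAdd 1)} =
      (⊤ : Subgroup (Monoid.Coprod (Multiplicative (ZMod 2)) (Multiplicative (ZMod 2)))) := by
  rw [eq_top_iff, ← Monoid.Coprod.closure_range_inl_union_inr, Subgroup.closure_le]
  rintro _ (⟨z, rfl⟩ | ⟨z, rfl⟩) <;> obtain h | h := eq_one_or_eq_ofAdd_one z
  · rw [h, MonoidHom.map_one]; exact one_mem _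
  · rw [h]; exact Subgroup.subset_closure (Or.inl rfl)
  · rw [h, MonoidHom.map_one]; exact one_mem _
  · rw [h]; exact Subgroup.subset_closure (Or.inr rfl)

lemma zpow_mul_ne_one_of_involutions (hx : x * x = 1) (hy : y * y = 1)
    (hxy : ∀ k : ℤ, (x * y) ^ k = 1 → k = 0) (k : ℤ) : (x * y) ^ k * x ≠ 1 := by
  intro h
  have hx1 : x = (x * y) ^ (-k) := by rw [zpow_neg]; exact eq_inv_of_mul_eq_one_right h
  have h2 : (x * y) ^ (-k + -k) = 1 := by rw [zpow_add, ← hx1, hx]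
  have hk : -k = 0 := by have := hxy _ h2; omega
  rw [hk, zpow_zero] at hx1
  have := hxy 2 (by rw [hx1, one_mul, zpow_two, hy])
  omega

/-- Two involutions with product of infinite order generate a free product. -/
lemma nonempty_closure_involutions_mulEquiv (hx : x * x = 1) (hy : y * y = 1)
    (hxy : ∀ k : ℤ, (x * y) ^ k = 1 → k = 0) :
    Nonempty (Subgroup.closure {x, y} ≃*
      Monoid.Coprod (Multiplicative (ZMod 2)) (Multiplicative (ZMod 2))) := by
  let f := Monoid.Coprod.lift (involutionHom x hx) (involutionHom y hy)
  have hfl : f (Monoid.Coprod.inl (Multiplicative.ofAdd 1)) = x := by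
    simp [f, involutionHom_ofAdd_one]
  have hfr : f (Monoid.Coprod.inr (Multiplicative.ofAdd 1)) = y := by
    simp [f, involutionHom_ofAdd_one]
  have hsq : (Multiplicative.ofAdd 1 : Multiplicative (ZMod 2)) * Multiplicative.ofAdd 1 = 1 := by
    decide
  have hinj : Function.Injective f := by
    rw [injective_iff_map_eq_one]
    intro g hg
    obtain ⟨k, hk | hk⟩ := exists_zpow_of_mem_closure_involutions
      (x := Monoid.Coprod.inl (Multiplicative.ofAdd 1))
      (y := Monoid.Coprod.inr (Multiplicative.ofAdd 1))
      (by rw [← map_mul, hsq, map_one]) (by rw [← map_mul, hsq, map_one])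
      (closure_inl_inr_ofAdd_one ▸ Subgroup.mem_top g)
    · rw [hk, map_zpow, map_mul, hfl, hfr] at hg
      rw [hk, hxy k hg, zpow_zero]
    · rw [hk, map_mul, map_zpow, map_mul, hfl, hfr] at hg
      exact absurd hg (zpow_mul_ne_one_of_involutions hx hy hxy k)
  have hrange : f.range = Subgroup.closure {x, y} := by
    rw [MonoidHom.range_eq_map, ← closure_inl_inr_ofAdd_one, MonoidHom.map_closure,
      Set.image_pair, hfl, hfr]
  exact ⟨((MonoidHom.ofInjective hinj).trans (MulEquiv.subgroupCongr hrange)).symm⟩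

/-- The infinite dihedral group has trivial centre. -/
lemma eq_one_of_mem_closure_involutions_of_commute (hx : x * x = 1) (hy : y * y = 1)
    (hxy : ∀ k : ℤ, (x * y) ^ k = 1 → k = 0) {g : M} (hg : g ∈ Subgroup.closure {x, y})
    (hgx : Commute g x) (hgy : Commute g y) : g = 1 := by
  obtain ⟨k, rfl | rfl⟩ := exists_zpow_of_mem_closure_involutions hx hy hg
  · have h := hgx.eq
    rw [mul_zpow_mul_of_involutions hx hy, mul_right_cancel_iff] at h
    have h2 : (x * y) ^ (k + k) = 1 := by
      nth_rewrite 1 [zpow_add, h]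
      rw [← zpow_add, neg_add_cancel, zpow_zero]
    have := hxy _ h2
    rw [show k = 0 by omega, zpow_zero]
  · have h := (hgx.mul_right hgy).eq
    have h1 := mul_zpow_mul_of_involutions hx hy 1
    rw [zpow_one] at h1
    rw [mul_assoc, h1, ← mul_assoc, ← mul_assoc, mul_right_cancel_iff, ← zpow_add,
      ← zpow_one_add] at h
    have h2 : (x * y) ^ (2 : ℤ) = 1 := by
      have h3 : (x * y) ^ (1 + k) * ((x * y) ^ (k + -1))⁻¹ = 1 := by rw [h, mul_inv_cancel]
      rw [← zpow_neg, ← zpow_add] at h3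
      rwa [show (1 + k + -(k + -1)) = 2 by ring] at h3
    have := hxy 2 h2
    omega

end Involutions

section Action

lemma one_smul_pic (v : Pic) : (1 : PicAut) • v = v := one_smul _ v

lemma mul_smul_pic (g h : PicAut) (v : Pic) : (g * h) • v = g • h • v := mul_smul g h v

lemma inv_smul_pic_eq {g : PicAut} {v w : Pic} (h : g • w = v) : g⁻¹ • v = w := by
  rw [← h, ← mul_smul_pic, inv_mul_cancel, one_smul_pic]

lemma smul_pic_add (g : PicAut) (v w : Pic) : g • (v + w) = g • v + g • w :=
  Matrix.mulVec_add _ _ _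

lemma smul_pic_zsmul (g : PicAut) (k : ℤ) (v : Pic) : g • (k • v) = k • (g • v) :=
  Matrix.mulVec_smul _ _ _

lemma smul_pic_neg (g : PicAut) (v : Pic) : g • (-v) = -(g • v) :=
  Matrix.mulVec_neg _ _

lemma zpow_smul_of_translation {t : PicAut} {v d : Pic} (hd : t • d = d) (hv : t • v = v + d)
    (k : ℤ) : t ^ k • v = v + k • d := by
  have hd' : t⁻¹ • d = d := inv_smul_pic_eq hd
  have hv' : t⁻¹ • v = v + -d := by
    apply inv_smul_pic_eq
    rw [smul_pic_add, smul_pic_neg, hd, hv, add_neg_cancel_right]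
  induction k using Int.induction_on with
  | zero => simp [one_smul_pic]
  | succ n ih =>
    rw [add_comm, zpow_one_add, mul_smul_pic, ih, smul_pic_add, smul_pic_zsmul, hd, hv, add_smul,
      one_smul, add_assoc]
  | pred n ih =>
    rw [sub_eq_add_neg, add_comm, zpow_add, zpow_neg_one, mul_smul_pic, ih, smul_pic_add,
      smul_pic_zsmul, hd', hv', add_smul, neg_one_smul, add_assoc]

lemma eq_zero_of_zpow_eq_one {t : PicAut} {v : Pic} (hd : t • dl = dl) (hv : t • v = v + dl)
    (k : ℤ) (hk : t ^ k = 1) : k = 0 := by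
  have h := zpow_smul_of_translation hd hv k
  rw [hk, one_smul_pic, left_eq_add] at h
  have := congr_fun h 2
  simpa [dl] using this

end Action

/-- The reflection in `α₀ + α₃`, as an element of `G_β`. -/
def reflB : PicAut := w0 * w3 * w0
/-- The rotation `(σ₁σ₂)²`. -/
def rotB : PicAut := (sg1 * sg2) ^ 2
/-- The involution `σ₂w₂w₀` of `G_γ`. -/
def invG : PicAut := sg2 * w2 * w0
/-- The reflection in `α₀ + α₁`. -/
def reflS : PicAut := w0 * w1 * w0
/-- The reflection in `α₂ + α₃`. -/
def reflS' : PicAut := rotB * reflS * rotB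

lemma reflB_mul_self : reflB * reflB = 1 := by apply Units.ext; decide +kernel
lemma rotB_mul_self : rotB * rotB = 1 := by apply Units.ext; decide +kernel
lemma invG_mul_self : invG * invG = 1 := by apply Units.ext; decide +kernel
lemma sg1_mul_self : sg1 * sg1 = 1 := by apply Units.ext; decide +kernel
lemma reflS_mul_self : reflS * reflS = 1 := by apply Units.ext; decide +kernel
lemma reflS'_mul_self : reflS' * reflS' = 1 := by apply Units.ext; decide +kernel

lemma Gb_eq_closure : Gb = Subgroup.closure {reflB, rotB} := by
  have h : w1 * w2 * w1 = rotB * reflB * rotB := by apply Units.ext; decide +kernel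
  have hr : reflB ∈ Subgroup.closure {reflB, rotB} := Subgroup.subset_closure (by simp)
  have hp : rotB ∈ Subgroup.closure {reflB, rotB} := Subgroup.subset_closure (by simp)
  apply le_antisymm
  · rw [Gb, Subgroup.closure_le]
    rintro _ (rfl | rfl | rfl)
    · exact hr
    · rw [h]; exact mul_mem (mul_mem hp hr) hp
    · exact hp
  · apply Subgroup.closure_mono
    rintro _ (rfl | rfl)
    · exact Or.inl rfl
    · exact Or.inr (Or.inr rfl)

lemma Gg_eq_closure : Gg = Subgroup.closure {invG, sg1} := by
  have h : sg1 * sg2 * sg1 * w3 * w1 = sg1 * invG * sg1 := by apply Units.ext; decide +kernel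
  have ha : invG ∈ Subgroup.closure {invG, sg1} := Subgroup.subset_closure (by simp)
  have hs : sg1 ∈ Subgroup.closure {invG, sg1} := Subgroup.subset_closure (by simp)
  apply le_antisymm
  · rw [Gg, Subgroup.closure_le]
    rintro _ (rfl | rfl | rfl)
    · exact ha
    · rw [h]; exact mul_mem (mul_mem hs ha) hs
    · exact hs
  · apply Subgroup.closure_mono
    rintro _ (rfl | rfl)
    · exact Or.inl rfl
    · exact Or.inr (Or.inr rfl)

lemma reflB_mul_rotB_zpow (k : ℤ) (h : (reflB * rotB) ^ k = 1) : k = 0 :=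
  eq_zero_of_zpow_eq_one (v := al0 + al3) (by decide +kernel) (by decide +kernel) k h

lemma invG_mul_sg1_zpow (k : ℤ) (h : (invG * sg1) ^ k = 1) : k = 0 :=
  eq_zero_of_zpow_eq_one (v := al0 + al2) (by decide +kernel) (by decide +kernel) k h

lemma commute_of_mem_Gb_of_mem_Gg {a b : PicAut} (ha : a ∈ Gb) (hb : b ∈ Gg) : Commute a b := by
  have h : Gb ≤ Subgroup.centralizer (Gg : Set PicAut) := by
    rw [Gb_eq_closure, Gg_eq_closure, Subgroup.centralizer_closure, Subgroup.closure_le]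
    rintro _ (rfl | rfl) <;> refine Subgroup.mem_centralizer_iff.2 ?_ <;>
      rintro _ (rfl | rfl) <;> apply Units.ext <;> decide +kernel
  exact (Subgroup.mem_centralizer_iff.1 (h ha) b hb).symm

lemma Gb_inf_Gg : Gb ⊓ Gg = ⊥ := by
  rw [eq_bot_iff]
  rintro g ⟨hb, hg⟩
  have hgen : ∀ y ∈ ({reflB, rotB} : Set PicAut), Commute g y := fun y hy =>
    (commute_of_mem_Gb_of_mem_Gg (Gb_eq_closure ▸ Subgroup.subset_closure hy) hg).symm
  exact eq_one_of_mem_closure_involutions_of_commute reflB_mul_self rotB_mul_self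
    reflB_mul_rotB_zpow (Gb_eq_closure ▸ hb) (hgen _ (by simp)) (hgen _ (by simp))

lemma mem_stabilizer_Spair {g : PicAut}
    (h : (g • (al0 + al1) = al0 + al1 ∧ g • (al2 + al3) = al2 + al3) ∨
      (g • (al0 + al1) = al2 + al3 ∧ g • (al2 + al3) = al0 + al1)) :
    g ∈ MulAction.stabilizer PicAut Spair := by
  rw [MulAction.mem_stabilizer_iff, Spair, Set.smul_set_insert, Set.smul_set_singleton]
  rcases h with ⟨h1, h2⟩ | ⟨h1, h2⟩
  · rw [h1, h2]
  · rw [h1, h2, Set.pair_comm]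

lemma Wh_generators_mem : w0 ∈ Wh ∧ w1 ∈ Wh ∧ w2 ∈ Wh ∧ w3 ∈ Wh ∧ sg1 ∈ Wh ∧ sg2 ∈ Wh := by
  refine ⟨?_, ?_, ?_, ?_, ?_, ?_⟩ <;> exact Subgroup.subset_closure (by simp)

lemma Gb_le_G : Gb ≤ G := by
  obtain ⟨h0, -, -, h3, hs1, hs2⟩ := Wh_generators_mem
  rw [Gb_eq_closure, Subgroup.closure_le]
  rintro _ (rfl | rfl)
  · exact ⟨mul_mem (mul_mem h0 h3) h0, mem_stabilizer_Spair (by decide +kernel)⟩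
  · exact ⟨pow_mem (mul_mem hs1 hs2) 2, mem_stabilizer_Spair (by decide +kernel)⟩

lemma Gg_le_G : Gg ≤ G := by
  obtain ⟨h0, -, h2, -, hs1, hs2⟩ := Wh_generators_mem
  rw [Gg_eq_closure, Subgroup.closure_le]
  rintro _ (rfl | rfl)
  · exact ⟨mul_mem (mul_mem hs2 h2) h0, mem_stabilizer_Spair (by decide +kernel)⟩
  · exact ⟨hs1, mem_stabilizer_Spair (by decide +kernel)⟩

/-- The infinite dihedral group generated by the reflections in `α₀ + α₁` and `α₂ + α₃`. -/
def reflGroup : Subgroup PicAut := Subgroup.closure {reflS, reflS'}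

lemma reflS_mem : reflS ∈ reflGroup := Subgroup.subset_closure (by simp)

lemma reflS'_mem : reflS' ∈ reflGroup := Subgroup.subset_closure (by simp)

/-- The generators of `G_β` and `G_γ` normalize the reflection group. -/
lemma exists_mul_eq_mul_of_generator {y d : PicAut}
    (hy : y ∈ ({reflB, rotB, invG, sg1} : Set PicAut)) (hd : d ∈ reflGroup) :
    ∃ d' ∈ reflGroup, y * d = d' * y := by
  have key : (y * reflS = reflS * y ∧ y * reflS' = reflS' * y) ∨
      (y * reflS = reflS' * y ∧ y * reflS' = reflS * y) := by
    simp only [← Units.val_inj]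
    rcases hy with rfl | rfl | rfl | rfl <;> decide +kernel
  have hconj : reflGroup ≤ reflGroup.comap (MulAut.conj y).toMonoidHom := by
    conv_lhs => rw [reflGroup]
    rw [Subgroup.closure_le]
    rintro _ (rfl | rfl) <;>
      simp only [SetLike.mem_coe, Subgroup.mem_comap, MulEquiv.coe_toMonoidHom,
        MulAut.conj_apply] <;>
      rcases key with ⟨h1, h2⟩ | ⟨h1, h2⟩ <;>
      simp only [h1, h2, mul_inv_cancel_right, reflS_mem, reflS'_mem]
  exact ⟨y * d * y⁻¹, hconj hd, by group⟩

/-- Coset representatives of the setwise stabilizer of `±(α₀ + α₁) + ℤδ`. -/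
def cosetReps : Set PicAut := {1, sg2, w0, w1, w2, w3}

/-- The elements of `Wh` written as a coset representative times a product of an element of the
reflection group and an element of `G_β G_γ`. -/
def decomposable : Set PicAut :=
  {g | ∃ c ∈ cosetReps, ∃ d ∈ reflGroup, ∃ h ∈ Gb ⊔ Gg, g = c * (d * h)}

lemma generators_mem_sup : reflB ∈ Gb ⊔ Gg ∧ rotB ∈ Gb ⊔ Gg ∧ invG ∈ Gb ⊔ Gg ∧ sg1 ∈ Gb ⊔ Gg := by
  have h1 : ({reflB, rotB} : Set PicAut) ⊆ Gb := Gb_eq_closure ▸ Subgroup.subset_closure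
  have h2 : ({invG, sg1} : Set PicAut) ⊆ Gg := Gg_eq_closure ▸ Subgroup.subset_closure
  exact ⟨le_sup_left (a := Gb) (h1 (by simp)), le_sup_left (a := Gb) (h1 (by simp)),
    le_sup_right (a := Gb) (h2 (by simp)), le_sup_right (a := Gb) (h2 (by simp))⟩

/-- The subgroup generated by the reflection group and `G_β G_γ`. -/
def lineStabilizer : Subgroup PicAut := Subgroup.closure {reflS, reflB, rotB, invG, sg1}

lemma exists_mul_eq_of_mem_lineStabilizer {k d h : PicAut} (hk : k ∈ lineStabilizer)
    (hd : d ∈ reflGroup) (hh : h ∈ Gb ⊔ Gg) :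
    ∃ d' ∈ reflGroup, ∃ h' ∈ Gb ⊔ Gg, k * (d * h) = d' * h' := by
  have step : ∀ z ∈ ({reflS, reflB, rotB, invG, sg1} : Set PicAut), ∀ d ∈ reflGroup,
      ∀ h ∈ Gb ⊔ Gg, ∃ d' ∈ reflGroup, ∃ h' ∈ Gb ⊔ Gg, z * (d * h) = d' * h' := by
    intro z hz d hd h hh
    rcases hz with rfl | hz
    · exact ⟨_, mul_mem reflS_mem hd, h, hh, (mul_assoc _ _ _).symm⟩
    · obtain ⟨d', hd', e⟩ := exists_mul_eq_mul_of_generator hz hd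
      have hzm : z ∈ Gb ⊔ Gg := by
        obtain ⟨h1, h2, h3, h4⟩ := generators_mem_sup
        rcases hz with rfl | rfl | rfl | rfl <;> assumption
      exact ⟨d', hd', z * h, mul_mem hzm hh, by rw [← mul_assoc, e, mul_assoc]⟩
  have hinv : ∀ z ∈ ({reflS, reflB, rotB, invG, sg1} : Set PicAut), z⁻¹ = z := by
    rintro z (rfl | rfl | rfl | rfl | rfl) <;> apply inv_eq_of_mul_eq_one_left
    exacts [reflS_mul_self, reflB_mul_self, rotB_mul_self, invG_mul_self, sg1_mul_self]
  induction hk using Subgroup.closure_induction_left with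
  | one => exact ⟨d, hd, h, hh, one_mul _⟩
  | mul_left z hz g _ ih =>
    obtain ⟨d', hd', h', hh', e⟩ := ih
    rw [mul_assoc, e]
    exact step z hz d' hd' h' hh'
  | inv_mul_cancel z hz g _ ih =>
    obtain ⟨d', hd', h', hh', e⟩ := ih
    rw [mul_assoc, e, hinv z hz]
    exact step z hz d' hd' h' hh'

set_option maxHeartbeats 1000000 in
lemma exists_mul_cosetRep {w c : PicAut} (hw : w ∈ ({w0, w1, w2, w3, sg1, sg2} : Set PicAut))
    (hc : c ∈ cosetReps) : ∃ c' ∈ cosetReps, ∃ k ∈ lineStabilizer, w * c = c' * k := by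
  have hgen : ∀ y ∈ ({reflS, reflB, rotB, invG, sg1} : Set PicAut), y ∈ lineStabilizer :=
    fun y hy => Subgroup.subset_closure hy
  have hS : reflS ∈ lineStabilizer := hgen _ (by simp)
  have hB : reflB ∈ lineStabilizer := hgen _ (by simp)
  have hR : rotB ∈ lineStabilizer := hgen _ (by simp)
  have hI : invG ∈ lineStabilizer := hgen _ (by simp)
  have hX : sg1 ∈ lineStabilizer := hgen _ (by simp)
  have h1 : (1 : PicAut) ∈ lineStabilizer := one_mem _
  have hRX : rotB * sg1 ∈ lineStabilizer := mul_mem hR hX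
  have hRSR : rotB * reflS * rotB ∈ lineStabilizer := mul_mem (mul_mem hR hS) hR
  have hRBR : rotB * reflB * rotB ∈ lineStabilizer := mul_mem (mul_mem hR hB) hR
  have hRXIX : rotB * sg1 * invG * sg1 ∈ lineStabilizer := mul_mem (mul_mem hRX hI) hX
  have find : ∀ c' ∈ cosetReps, ∀ k ∈ lineStabilizer, (w * c).val = (c' * k).val →
      ∃ c' ∈ cosetReps, ∃ k ∈ lineStabilizer, w * c = c' * k :=
    fun c' hc' k hk e => ⟨c', hc', k, hk, Units.ext e⟩
  have m1 : 1 ∈ cosetReps := by simp [cosetReps]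
  have ms : sg2 ∈ cosetReps := by simp [cosetReps]
  have m_w0 : w0 ∈ cosetReps := by simp [cosetReps]
  have m_w1 : w1 ∈ cosetReps := by simp [cosetReps]
  have m_w2 : w2 ∈ cosetReps := by simp [cosetReps]
  have m_w3 : w3 ∈ cosetReps := by simp [cosetReps]
  rcases hw with rfl | rfl | rfl | rfl | rfl | rfl
  · rcases hc with rfl | rfl | rfl | rfl | rfl | rfl
    exacts [find _ m_w0 _ h1 (by decide +kernel),
      find _ m_w2 _ hI (by decide +kernel),
      find _ m1 _ h1 (by decide +kernel),
      find _ m_w1 _ hS (by decide +kernel),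
      find _ ms _ hI (by decide +kernel),
      find _ m_w3 _ hB (by decide +kernel)]
  · rcases hc with rfl | rfl | rfl | rfl | rfl | rfl
    exacts [find _ m_w1 _ h1 (by decide +kernel),
      find _ m_w3 _ hRXIX (by decide +kernel),
      find _ m_w0 _ hS (by decide +kernel),
      find _ m1 _ h1 (by decide +kernel),
      find _ m_w2 _ hRBR (by decide +kernel),
      find _ ms _ hRXIX (by decide +kernel)]
  · rcases hc with rfl | rfl | rfl | rfl | rfl | rfl
    exacts [find _ m_w2 _ h1 (by decide +kernel),
      find _ m_w0 _ hI (by decide +kernel),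
      find _ ms _ hI (by decide +kernel),
      find _ m_w1 _ hRBR (by decide +kernel),
      find _ m1 _ h1 (by decide +kernel),
      find _ m_w3 _ hRSR (by decide +kernel)]
  · rcases hc with rfl | rfl | rfl | rfl | rfl | rfl
    exacts [find _ m_w3 _ h1 (by decide +kernel),
      find _ m_w1 _ hRXIX (by decide +kernel),
      find _ m_w0 _ hB (by decide +kernel),
      find _ ms _ hRXIX (by decide +kernel),
      find _ m_w2 _ hRSR (by decide +kernel),
      find _ m1 _ h1 (by decide +kernel)]
  · rcases hc with rfl | rfl | rfl | rfl | rfl | rfl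
    exacts [find _ m1 _ hX (by decide +kernel),
      find _ ms _ hRX (by decide +kernel),
      find _ m_w3 _ hX (by decide +kernel),
      find _ m_w2 _ hX (by decide +kernel),
      find _ m_w1 _ hX (by decide +kernel),
      find _ m_w0 _ hX (by decide +kernel)]
  · rcases hc with rfl | rfl | rfl | rfl | rfl | rfl
    exacts [find _ ms _ h1 (by decide +kernel),
      find _ m1 _ h1 (by decide +kernel),
      find _ m_w0 _ hI (by decide +kernel),
      find _ m_w3 _ hRXIX (by decide +kernel),
      find _ m_w2 _ hI (by decide +kernel),
      find _ m_w1 _ hRXIX (by decide +kernel)]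

lemma Wh_subset_decomposable {g : PicAut} (hg : g ∈ Wh) : g ∈ decomposable := by
  have step : ∀ w ∈ ({w0, w1, w2, w3, sg1, sg2} : Set PicAut), ∀ g ∈ decomposable,
      w * g ∈ decomposable := by
    rintro w hw _ ⟨c, hc, d, hd, h, hh, rfl⟩
    obtain ⟨c', hc', k, hk, e⟩ := exists_mul_cosetRep hw hc
    obtain ⟨d', hd', h', hh', e'⟩ := exists_mul_eq_of_mem_lineStabilizer hk hd hh
    exact ⟨c', hc', d', hd', h', hh', by rw [← mul_assoc, e, mul_assoc, e']⟩
  induction hg using Subgroup.closure_induction_left with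
  | one => exact ⟨1, by simp [cosetReps], 1, one_mem _, 1, one_mem _, by simp⟩
  | mul_left w hw g _ ih => exact step w hw g ih
  | inv_mul_cancel w hw g _ ih =>
    have hw' : w⁻¹ = w := by
      apply inv_eq_of_mul_eq_one_left
      rcases hw with rfl | rfl | rfl | rfl | rfl | rfl <;> apply Units.ext <;> decide +kernel
    rw [hw']
    exact step w hw g ih

lemma reflGroup_smul {d : PicAut} (hd : d ∈ reflGroup) :
    ∃ k : ℤ, (d = (reflS * reflS') ^ k ∧ d • (al0 + al1) = (al0 + al1) + (2 * k) • dl) ∨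
      d • (al0 + al1) = -((al0 + al1) + (2 * k) • dl) := by
  have hT : ∀ k : ℤ, (reflS * reflS') ^ k • (al0 + al1) = (al0 + al1) + (2 * k) • dl := by
    intro k
    rw [zpow_smul_of_translation (d := (2 : ℤ) • dl) (by decide +kernel) (by decide +kernel) k,
      smul_smul, mul_comm]
  have hS : reflS • (al0 + al1) = -(al0 + al1) := by decide +kernel
  obtain ⟨k, rfl | rfl⟩ :=
    exists_zpow_of_mem_closure_involutions reflS_mul_self reflS'_mul_self hd
  · exact ⟨k, Or.inl ⟨rfl, hT k⟩⟩
  · exact ⟨k, Or.inr (by rw [mul_smul_pic, hS, smul_pic_neg, hT])⟩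

lemma cosetRep_smul_dl {c : PicAut} (hc : c ∈ cosetReps) : c • dl = dl := by
  rcases hc with rfl | rfl | rfl | rfl | rfl | rfl <;> decide +kernel

lemma cosetRep_smul_root {c : PicAut} (hc : c ∈ cosetReps) : c = 1 ∨
    c • (al0 + al1) ∈ [al1 + al2, al1, al0, dl - al3, dl - al2] := by
  rcases hc with rfl | rfl | rfl | rfl | rfl | rfl
  · exact Or.inl rfl
  all_goals right; decide +kernel

lemma eq_one_of_smul_mem_Spair {c d : PicAut} (hc : c ∈ cosetReps) (hd : d ∈ reflGroup)
    (h : (c * d) • (al0 + al1) ∈ Spair) : c * d = 1 := by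
  rw [mul_smul_pic] at h
  have hdl := cosetRep_smul_dl hc
  have hroot := cosetRep_smul_root hc
  simp only [List.mem_cons, List.not_mem_nil, or_false] at hroot
  obtain ⟨k, ⟨hdk, hk⟩ | hk⟩ := reflGroup_smul hd
  · rw [hk, smul_pic_add, smul_pic_zsmul, hdl] at h
    rcases hroot with rfl | e | e | e | e | e
    · have hk0 : k = 0 := by
        rw [one_smul_pic] at h
        rcases h with h | h <;> have h4 := congr_fun h 4 <;> simp [al0, al1, al2, al3, dl] at h4 <;>
          omega
      rw [hdk, hk0, zpow_zero, one_mul]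
    all_goals
      exfalso
      rw [e] at h
      rcases h with h | h <;>
        have h2 := congr_fun h 2 <;> have h4 := congr_fun h 4 <;> have h6 := congr_fun h 6 <;>
        have h8 := congr_fun h 8 <;> simp [al0, al1, al2, al3, dl] at h2 h4 h6 h8 <;> omega
  · rw [hk, smul_pic_neg, smul_pic_add, smul_pic_zsmul, hdl] at h
    exfalso
    rcases hroot with rfl | e | e | e | e | e
    · rw [one_smul_pic] at h
      rcases h with h | h <;> have h2 := congr_fun h 2 <;> have h4 := congr_fun h 4 <;>
        simp [al0, al1, al2, al3, dl] at h2 h4 <;> omega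
    all_goals
      rw [e] at h
      rcases h with h | h <;>
        have h2 := congr_fun h 2 <;> have h4 := congr_fun h 4 <;> have h6 := congr_fun h 6 <;>
        have h8 := congr_fun h 8 <;> simp [al0, al1, al2, al3, dl] at h2 h4 h6 h8 <;> omega

lemma G_eq_sup : G = Gb ⊔ Gg := by
  have hle : Gb ⊔ Gg ≤ G := sup_le Gb_le_G Gg_le_G
  refine le_antisymm ?_ hle
  intro g hg
  obtain ⟨c, hc, d, hd, h, hh, rfl⟩ := Wh_subset_decomposable hg.1
  have hcd : c * d ∈ G := by
    have := mul_mem hg (inv_mem (hle hh))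
    rwa [← mul_assoc, mul_inv_cancel_right] at this
  have hmem : (c * d) • (al0 + al1) ∈ Spair := by
    have hst : (c * d) • Spair = Spair := hcd.2
    rw [← hst]
    exact Set.smul_mem_smul_set (Or.inl rfl)
  rwa [← mul_assoc, eq_one_of_smul_mem_Spair hc hd hmem, one_mul]

/-- Every element of `G_β` commutes with every element of `G_γ`, `G_β ∩ G_γ = {1}`,
`G = G_β · G_γ`, each of `G_β`, `G_γ` is isomorphic to the free product `ℤ/2 * ℤ/2`
(the infinite dihedral group), and `G` is isomorphic to the direct product of two
infinite dihedral groups. -/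
theorem stmt1 :
    (∀ a ∈ Gb, ∀ b ∈ Gg, Commute a b) ∧
    Gb ⊓ Gg = ⊥ ∧
    (G : Set PicAut) = (Gb : Set PicAut) * (Gg : Set PicAut) ∧
    Nonempty (Gb ≃* Monoid.Coprod (Multiplicative (ZMod 2)) (Multiplicative (ZMod 2))) ∧
    Nonempty (Gg ≃* Monoid.Coprod (Multiplicative (ZMod 2)) (Multiplicative (ZMod 2))) ∧
    Nonempty (G ≃* (Monoid.Coprod (Multiplicative (ZMod 2)) (Multiplicative (ZMod 2))) × (Monoid.Coprod (Multiplicative (ZMod 2)) (Multiplicative (ZMod 2)))) := by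
  have hcomm : ∀ (a : Gb) (b : Gg), Commute (Gb.subtype a) (Gg.subtype b) := fun a b =>
    commute_of_mem_Gb_of_mem_Gg a.2 b.2
  let f := MonoidHom.noncommCoprod Gb.subtype Gg.subtype hcomm
  have hrange : f.range = G := by
    rw [MonoidHom.noncommCoprod_range, Subgroup.range_subtype, Subgroup.range_subtype, G_eq_sup]
  have hinj : Function.Injective f := by
    rw [MonoidHom.noncommCoprod_injective, Subgroup.range_subtype, Subgroup.range_subtype]
    exact ⟨Subgroup.subtype_injective _, Subgroup.subtype_injective _,
      disjoint_iff.2 Gb_inf_Gg⟩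
  have hGb : Nonempty (Gb ≃*
      Monoid.Coprod (Multiplicative (ZMod 2)) (Multiplicative (ZMod 2))) := by
    rw [Gb_eq_closure]
    exact nonempty_closure_involutions_mulEquiv reflB_mul_self rotB_mul_self reflB_mul_rotB_zpow
  have hGg : Nonempty (Gg ≃*
      Monoid.Coprod (Multiplicative (ZMod 2)) (Multiplicative (ZMod 2))) := by
    rw [Gg_eq_closure]
    exact nonempty_closure_involutions_mulEquiv invG_mul_self sg1_mul_self invG_mul_sg1_zpow
  refine ⟨fun a ha b hb => commute_of_mem_Gb_of_mem_Gg ha hb, Gb_inf_Gg, ?_, hGb, hGg, ?_⟩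
  · rw [← hrange]
    ext g
    constructor
    · rintro ⟨⟨a, b⟩, rfl⟩
      exact Set.mul_mem_mul a.2 b.2
    · rintro ⟨a, ha, b, hb, rfl⟩
      exact ⟨(⟨a, ha⟩, ⟨b, hb⟩), rfl⟩
  · obtain ⟨eb⟩ := hGb
    obtain ⟨eg⟩ := hGg
    exact ⟨((MonoidHom.ofInjective hinj).trans (MulEquiv.subgroupCongr hrange)).symm.trans
      (eb.prodCongr eg)⟩
end

section
/- The element ψ_* = σ1∘σ2∘σ1∘σ2∘w3∘w1∘w2∘w0 of Ŵ satisfies ψ_*(α0) = α0 − δ, ψ_*(α1) = α1 + δ, ψ_*(α2) = α2 − δ, ψ_*(α3) = α3 + δ; equivalently, ψ_*(v) = v − (h•v)δ for every v in the ℚ-span of α0, α1, α2, α3, where h = (α1+α3)/2 = h1 − h2 + h3. -/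
open Pointwise

/-- `Pic ⊗ ℚ`. -/
abbrev PicQ : Type := Fin 10 → ℚ

/-- The intersection form on `Pic ⊗ ℚ`. -/
def interQ (x y : PicQ) : ℚ :=
  x 0 * y 1 + x 1 * y 0 -
    (x 2 * y 2 + x 3 * y 3 + x 4 * y 4 + x 5 * y 5 + x 6 * y 6 +
      x 7 * y 7 + x 8 * y 8 + x 9 * y 9)

/-- The natural map `Pic → Pic ⊗ ℚ`. -/
def toQ (v : Pic) : PicQ := fun i => (v i : ℚ)

/-- The action of an automorphism of `Pic` on `Pic ⊗ ℚ`. -/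
def actQ (g : PicAut) (v : PicQ) : PicQ := (g.val.map (Int.cast : ℤ → ℚ)).mulVec v

/-- The fundamental weight `h₁ = (3α₁ + 2α₂ + α₃)/4` of the finite `A₃` subsystem. -/
def h1Q : PicQ := (3/4 : ℚ) • toQ al1 + (1/2 : ℚ) • toQ al2 + (1/4 : ℚ) • toQ al3
/-- The fundamental weight `h₂ = (α₁ + 2α₂ + α₃)/2` of the finite `A₃` subsystem. -/
def h2Q : PicQ := (1/2 : ℚ) • toQ al1 + (1 : ℚ) • toQ al2 + (1/2 : ℚ) • toQ al3
/-- The fundamental weight `h₃ = (α₁ + 2α₂ + 3α₃)/4` of the finite `A₃` subsystem. -/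
def h3Q : PicQ := (1/4 : ℚ) • toQ al1 + (1/2 : ℚ) • toQ al2 + (3/4 : ℚ) • toQ al3

/-- The ℚ-span of the symmetry roots `α₀, α₁, α₂, α₃`. -/
def symmSpan : Submodule ℚ PicQ :=
  Submodule.span ℚ ({toQ al0, toQ al1, toQ al2, toQ al3} : Set PicQ)

/-- `ψ⁎ = σ₁σ₂σ₁σ₂w₃w₁w₂w₀`. -/
def psi : PicAut := sg1 * sg2 * sg1 * sg2 * w3 * w1 * w2 * w0

lemma act_mul (g h : PicAut) (v : Pic) : act (g * h) v = act g (act h v) :=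
  mul_smul g h v

lemma act_psi_al0 : act psi al0 = al0 - dl := by
  simp only [psi, act_mul]
  decide

lemma act_psi_al1 : act psi al1 = al1 + dl := by
  simp only [psi, act_mul]
  decide

lemma act_psi_al2 : act psi al2 = al2 - dl := by
  simp only [psi, act_mul]
  decide

lemma act_psi_al3 : act psi al3 = al3 + dl := by
  simp only [psi, act_mul]
  decide

lemma toQ_add (x y : Pic) : toQ (x + y) = toQ x + toQ y := by
  ext i; simp [toQ]

lemma toQ_sub (x y : Pic) : toQ (x - y) = toQ x - toQ y := by
  ext i; simp [toQ]

lemma actQ_toQ (g : PicAut) (v : Pic) : actQ g (toQ v) = toQ (act g v) := by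
  ext i; simp [actQ, toQ, act, Matrix.mulVec, dotProduct]

lemma interQ_add (x y z : PicQ) : interQ x (y + z) = interQ x y + interQ x z := by
  simp only [interQ, Pi.add_apply]; ring

lemma interQ_smul (x : PicQ) (c : ℚ) (y : PicQ) : interQ x (c • y) = c * interQ x y := by
  simp only [interQ, Pi.smul_apply, smul_eq_mul]; ring

lemma half_sum_eq : (1/2 : ℚ) • (toQ al1 + toQ al3) = h1Q - h2Q + h3Q := by
  simp only [h1Q, h2Q, h3Q]; module

lemma interQ_half_smul_toQ (x y v : Pic) :
    interQ ((1/2 : ℚ) • (toQ x + toQ y)) (toQ v) = ((inter x v + inter y v : ℤ) : ℚ) / 2 := by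
  simp only [interQ, inter, toQ, Pi.smul_apply, Pi.add_apply, smul_eq_mul]
  push_cast
  ring

/-- `ψ⁎` maps `α₀ ↦ α₀ - δ`, `α₁ ↦ α₁ + δ`, `α₂ ↦ α₂ - δ`, `α₃ ↦ α₃ + δ`;
equivalently, `ψ⁎(v) = v - (h•v)δ` on the ℚ-span of the symmetry roots, where
`h = (α₁+α₃)/2 = h₁ - h₂ + h₃`. -/
theorem stmt4 :
    act psi al0 = al0 - dl ∧ act psi al1 = al1 + dl ∧
    act psi al2 = al2 - dl ∧ act psi al3 = al3 + dl ∧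
    (1/2 : ℚ) • (toQ al1 + toQ al3) = h1Q - h2Q + h3Q ∧
    ∀ v ∈ symmSpan,
      actQ psi v = v - interQ ((1/2 : ℚ) • (toQ al1 + toQ al3)) v • toQ dl := by
  refine ⟨act_psi_al0, act_psi_al1, act_psi_al2, act_psi_al3, half_sum_eq, fun v hv => ?_⟩
  induction hv using Submodule.span_induction with
  | mem x hx =>
    rcases hx with rfl | rfl | rfl | rfl
    · rw [actQ_toQ, act_psi_al0, interQ_half_smul_toQ,
        show inter al1 al0 + inter al3 al0 = 2 by decide, toQ_sub]
      norm_num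
    · rw [actQ_toQ, act_psi_al1, interQ_half_smul_toQ,
        show inter al1 al1 + inter al3 al1 = -2 by decide, toQ_add]
      norm_num
    · rw [actQ_toQ, act_psi_al2, interQ_half_smul_toQ,
        show inter al1 al2 + inter al3 al2 = 2 by decide, toQ_sub]
      norm_num
    · rw [actQ_toQ, act_psi_al3, interQ_half_smul_toQ,
        show inter al1 al3 + inter al3 al3 = -2 by decide, toQ_add]
      norm_num
  | zero => simp [actQ, interQ]
  | add x y _ _ hx hy =>
    rw [actQ, Matrix.mulVec_add, ← actQ, ← actQ, hx, hy, interQ_add]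
    module
  | smul c x _ hx =>
    rw [actQ, Matrix.mulVec_smul, ← actQ, hx, interQ_smul]
    module
end

section
/- Set 𝐓1 = σ2∘σ1∘w2∘w3∘w0, 𝐓2 = (σ1∘σ2)²∘w0∘w3∘w1∘w0, 𝐓3 = σ1∘σ2∘w2∘w1∘w0 ∈ Ŵ. Then the following identities hold in Ŵ: σ1∘σ2 = w1∘w2∘w3∘𝐓3, (σ1∘σ2)² = w2∘w3∘w1∘w2∘𝐓2, and σ2∘σ1 = w3∘w2∘w1∘𝐓1 (realizing the semi-direct product structure of the extended affine Weyl group of type A3^(1)). -/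
open Pointwise

/-- `𝐓₁ = σ₂σ₁w₂w₃w₀`. -/
def T1 : PicAut := sg2 * sg1 * w2 * w3 * w0
/-- `𝐓₂ = (σ₁σ₂)²w₀w₃w₁w₀`. -/
def T2 : PicAut := (sg1 * sg2) ^ 2 * w0 * w3 * w1 * w0
/-- `𝐓₃ = σ₁σ₂w₂w₁w₀`. -/
def T3 : PicAut := sg1 * sg2 * w2 * w1 * w0

lemma mkAut_mul_self (M : Matrix (Fin 10) (Fin 10) ℤ) (h : M * M = 1) :
    mkAut M h * mkAut M h = 1 :=
  Units.ext h

lemma sg1_mul_w0 : sg1 * w0 = w3 * sg1 :=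
  Units.ext (show permMat _ * reflMat mu * reflMat al0 =
    reflMat al3 * (permMat _ * reflMat mu) by decide)

lemma sg1_mul_w1 : sg1 * w1 = w2 * sg1 :=
  Units.ext (show permMat _ * reflMat mu * reflMat al1 =
    reflMat al2 * (permMat _ * reflMat mu) by decide)

lemma sg2_mul_w0 : sg2 * w0 = w2 * sg2 :=
  Units.ext (show permMat _ * reflMat al0 = reflMat al2 * permMat _ by decide)

lemma sg2_mul_w1 : sg2 * w1 = w1 * sg2 :=
  Units.ext (show permMat _ * reflMat al1 = reflMat al1 * permMat _ by decide)

lemma sg2_mul_w3 : sg2 * w3 = w3 * sg2 :=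
  Units.ext (show permMat _ * reflMat al3 = reflMat al3 * permMat _ by decide)

/-- An involution intertwining `v` and `w` also intertwines `w` and `v`. -/
lemma SemiconjBy.symm_of_mul_self {G : Type*} [Group G] {s v w : G} (hs : s * s = 1)
    (h : SemiconjBy s v w) : SemiconjBy s w v := by
  have := h.inv_symm_left
  rwa [inv_eq_of_mul_eq_one_left hs] at this

lemma sg1_mul_w3 : sg1 * w3 = w0 * sg1 :=
  SemiconjBy.symm_of_mul_self (mkAut_mul_self _ _) sg1_mul_w0

lemma sg1_mul_w2 : sg1 * w2 = w1 * sg1 :=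
  SemiconjBy.symm_of_mul_self (mkAut_mul_self _ _) sg1_mul_w1

lemma sg2_mul_w2 : sg2 * w2 = w0 * sg2 :=
  SemiconjBy.symm_of_mul_self (mkAut_mul_self _ _) sg2_mul_w0

/-- Conjugation by `σ₁σ₂` rotates the diagram: `wᵢ ↦ wᵢ₊₁`. -/
lemma semiconjBy_sg1_mul_sg2 :
    SemiconjBy (sg1 * sg2) w0 w1 ∧ SemiconjBy (sg1 * sg2) w1 w2 ∧
      SemiconjBy (sg1 * sg2) w2 w3 ∧ SemiconjBy (sg1 * sg2) w3 w0 :=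
  ⟨.mul_left sg1_mul_w2 sg2_mul_w0, .mul_left sg1_mul_w1 sg2_mul_w1,
    .mul_left sg1_mul_w0 sg2_mul_w2, .mul_left sg1_mul_w3 sg2_mul_w3⟩

/-- Conjugation by `σ₂σ₁` rotates the diagram backwards: `wᵢ ↦ wᵢ₋₁`. -/
lemma semiconjBy_sg2_mul_sg1 :
    SemiconjBy (sg2 * sg1) w0 w3 ∧ SemiconjBy (sg2 * sg1) w2 w1 ∧
      SemiconjBy (sg2 * sg1) w3 w2 :=
  ⟨.mul_left sg2_mul_w3 sg1_mul_w0, .mul_left sg2_mul_w1 sg1_mul_w2,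
    .mul_left sg2_mul_w0 sg1_mul_w3⟩

/-- The identities `σ₁σ₂ = w₁w₂w₃𝐓₃`, `(σ₁σ₂)² = w₂w₃w₁w₂𝐓₂`, `σ₂σ₁ = w₃w₂w₁𝐓₁`
hold in `Ŵ`. -/
theorem stmt7 :
    sg1 * sg2 = w1 * w2 * w3 * T3 ∧
    (sg1 * sg2) ^ 2 = w2 * w3 * w1 * w2 * T2 ∧
    sg2 * sg1 = w3 * w2 * w1 * T1 := by
  obtain ⟨h0, h1, h2, h3⟩ := semiconjBy_sg1_mul_sg2
  obtain ⟨k0, k2, k3⟩ := semiconjBy_sg2_mul_sg1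
  have e1 : w1⁻¹ = w1 := rfl
  have e2 : w2⁻¹ = w2 := rfl
  have e3 : w3⁻¹ = w3 := rfl
  have r0 : SemiconjBy ((sg1 * sg2) ^ 2) w0 w2 := by rw [sq]; exact h1.mul_left h0
  have r1 : SemiconjBy ((sg1 * sg2) ^ 2) w1 w3 := by rw [sq]; exact h2.mul_left h1
  have r3 : SemiconjBy ((sg1 * sg2) ^ 2) w3 w1 := by rw [sq]; exact h0.mul_left h3
  have c1 := ((h2.mul_right h1).mul_right h0).eq
  have c2 := (((r0.mul_right r3).mul_right r1).mul_right r0).eq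
  have c3 := ((k2.mul_right k3).mul_right k0).eq
  have t3 : T3 = (w1 * w2 * w3)⁻¹ * (sg1 * sg2) := by
    rw [mul_inv_rev, mul_inv_rev, e1, e2, e3, ← mul_assoc w3, ← c1]
    simp only [T3, mul_assoc]
  have t2 : T2 = (w2 * w3 * w1 * w2)⁻¹ * (sg1 * sg2) ^ 2 := by
    rw [mul_inv_rev, mul_inv_rev, mul_inv_rev, e1, e2, e3, ← mul_assoc w1, ← mul_assoc w2,
      ← mul_assoc w2, ← c2]
    simp only [T2, mul_assoc]
  have t1 : T1 = (w3 * w2 * w1)⁻¹ * (sg2 * sg1) := by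
    rw [mul_inv_rev, mul_inv_rev, e1, e2, e3, ← mul_assoc w1, ← c3]
    simp only [T1, mul_assoc]
  rw [t1, t2, t3]
  simp only [mul_inv_cancel_left, and_self]
end
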